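/- Let A be a symmetric skew left brace, B a sub-skew brace of A, and n ≥ 1. Then B and B·Ann_n(A) are n-isoclinic; in particular, if A = B·Ann_n(A), then A and B are n-isoclinic. Conversely, if A/Ann_n(A) is finite and A is n-isoclinic to B, then A = B·Ann_n(A). -/

import Mathlib

set_option linter.unusedVariables false

universe u v

/-- A skew left brace: a carrier with two group structures `(A,·)` (written `dmul`) and
`(A,∘)` (written `cmul`) sharing the same identity `ident`, satisfying
`a ∘ (b · c) = (a ∘ b) · a⁻¹ · (a ∘ c)`. -/
class SkewBrace (A : Type u) where
  dmul : A → A → A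
  ident : A
  dinv : A → A
  cmul : A → A → A
  cinv : A → A
  dmul_assoc : ∀ a b c : A, dmul (dmul a b) c = dmul a (dmul b c)
  ident_dmul : ∀ a : A, dmul ident a = a
  dmul_ident : ∀ a : A, dmul a ident = a
  dinv_dmul : ∀ a : A, dmul (dinv a) a = ident
  dmul_dinv : ∀ a : A, dmul a (dinv a) = ident
  cmul_assoc : ∀ a b c : A, cmul (cmul a b) c = cmul a (cmul b c)
  ident_cmul : ∀ a : A, cmul ident a = a
  cmul_ident : ∀ a : A, cmul a ident = a
  cinv_cmul : ∀ a : A, cmul (cinv a) a = ident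
  cmul_cinv : ∀ a : A, cmul a (cinv a) = ident
  compat : ∀ a b c : A, cmul a (dmul b c) = dmul (dmul (cmul a b) (dinv a)) (cmul a c)

namespace SkewBrace

variable {A : Type u} [SkewBrace A]

/-- The lambda map `λ_a(b) = a⁻¹ · (a ∘ b)`. -/
def lam (a b : A) : A := dmul (dinv a) (cmul a b)

/-- The star operation `a * b = λ_a(b) · b⁻¹`. -/
def bstar (a b : A) : A := dmul (lam a b) (dinv b)

/-- The dot commutator `[a,b]· = a · b · a⁻¹ · b⁻¹`. -/
def dcomm (a b : A) : A := dmul (dmul (dmul a b) (dinv a)) (dinv b)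

/-- The circle commutator `[a,b]∘ = a ∘ b ∘ ā ∘ b̄`. -/
def ccomm (a b : A) : A := cmul (cmul (cmul a b) (cinv a)) (cinv b)

/-- Membership in the subgroup of `(A,·)` generated by a subset. -/
inductive dclosure (S : Set A) : A → Prop
  | mem {x : A} : x ∈ S → dclosure S x
  | one : dclosure S ident
  | mul {x y : A} : dclosure S x → dclosure S y → dclosure S (dmul x y)
  | inv {x : A} : dclosure S x → dclosure S (dinv x)

/-- The subgroup of `(A,·)` generated by a subset, as a set. -/
def dcl (S : Set A) : Set A := {x | dclosure S x}

/-- Membership in the subgroup of `(A,∘)` generated by a subset. -/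
inductive cclosure (S : Set A) : A → Prop
  | mem {x : A} : x ∈ S → cclosure S x
  | one : cclosure S ident
  | mul {x y : A} : cclosure S x → cclosure S y → cclosure S (cmul x y)
  | inv {x : A} : cclosure S x → cclosure S (cinv x)

/-- The subgroup of `(A,∘)` generated by a subset, as a set. -/
def ccl (S : Set A) : Set A := {x | cclosure S x}

/-- The set `{x * y : x ∈ I, y ∈ J}` (star values). -/
def starSet (I J : Set A) : Set A := {x | ∃ a ∈ I, ∃ b ∈ J, x = bstar a b}

/-- The set of dot commutators `[a,b]·` with `a ∈ I`, `b ∈ J`. -/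
def dcommSet (I J : Set A) : Set A := {x | ∃ a ∈ I, ∃ b ∈ J, x = dcomm a b}

/-- The set of circle commutators `[a,b]∘` with `a ∈ I`, `b ∈ J`. -/
def ccommSet (I J : Set A) : Set A := {x | ∃ a ∈ I, ∃ b ∈ J, x = ccomm a b}

/-- The lower central series `Γ_n(A)` of the skew brace `A` (`Gamma A n = Γ_n(A)` for `n ≥ 1`):
`Γ₁(A) = A` and `Γ_n(A) = ⟨A * Γ_{n-1}(A), Γ_{n-1}(A) * A, [A,Γ_{n-1}(A)]·⟩·`. -/
def Gamma (A : Type u) [SkewBrace A] : ℕ → Set A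
  | 0 => Set.univ
  | 1 => Set.univ
  | (n+2) =>
      dcl (starSet Set.univ (Gamma A (n+1)) ∪ starSet (Gamma A (n+1)) Set.univ ∪
        dcommSet Set.univ (Gamma A (n+1)))

/-- The lower central series `γ_n(A,∘)` of the group `(A,∘)`
(`gammaCirc A n = γ_n(A,∘)` for `n ≥ 1`). -/
def gammaCirc (A : Type u) [SkewBrace A] : ℕ → Set A
  | 0 => Set.univ
  | 1 => Set.univ
  | (n+2) => ccl (ccommSet (gammaCirc A (n+1)) Set.univ)

/-- The series `Γ̄_n(A)`: `Γ̄₁(A) = A`, `Γ̄_n(A) = ⟨A * Γ̄_{n-1}(A), [A, Γ̄_{n-1}(A)]·⟩·`. -/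
def GammaBar (A : Type u) [SkewBrace A] : ℕ → Set A
  | 0 => Set.univ
  | 1 => Set.univ
  | (n+2) =>
      dcl (starSet Set.univ (GammaBar A (n+1)) ∪ dcommSet Set.univ (GammaBar A (n+1)))

/-- The annihilator series: `AnnS A n = Ann_n(A)`, with `Ann_0(A) = 1` and
`Ann_n(A) = {a | a*b, b*a, [a,b]· ∈ Ann_{n-1}(A) for all b}`. -/
def AnnS (A : Type u) [SkewBrace A] : ℕ → Set A
  | 0 => {ident}
  | (n+1) => {a | ∀ b : A, bstar a b ∈ AnnS A n ∧ bstar b a ∈ AnnS A n ∧ dcomm a b ∈ AnnS A n}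

/-- The alphabet `X = {γ·, γ̄·, *, *̄}` of brace commutator symbols. -/
inductive BWord : Type
  | g | gbar | s | sbar

/-- Evaluation of a single symbol of `X`. -/
def evalX : BWord → A → A → A
  | BWord.g => dcomm
  | BWord.gbar => fun a b => dcomm b a
  | BWord.s => bstar
  | BWord.sbar => fun a b => bstar b a

/-- `evalW e a n` is the value `m(a₀ a₁ ⋯ a_n)` of the degree-`n` brace commutator word
`m = (e 0)(e 1)⋯(e (n-1))` on the arguments `a 0, …, a n`:
`m(a₀ ⋯ a_n) = (e 0)(a₀, (e 1)(a₁, …, (e (n-1))(a_{n-1}, a_n)⋯))`. -/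
def evalW : (ℕ → BWord) → (ℕ → A) → ℕ → A
  | _, a, 0 => a 0
  | e, a, (n+1) => evalX (e 0) (a 0) (evalW (fun i => e (i+1)) (fun i => a (i+1)) n)

/-- `Asub A t = A_{(t)}`, the subgroup of `(A,·)` generated by all values of brace commutator
words of degree `≥ t`. -/
def Asub (A : Type u) [SkewBrace A] (t : ℕ) : Set A :=
  dcl {x | ∃ s : ℕ, t ≤ s ∧ ∃ (e : ℕ → BWord) (a : ℕ → A), x = evalW e a s}

/-- `Sset A r = S_r(A)`, the set of all values of brace commutator words of degree exactly `r`
(`S_0(A) = A`). -/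
def Sset (A : Type u) [SkewBrace A] (r : ℕ) : Set A :=
  {x | ∃ (e : ℕ → BWord) (a : ℕ → A), x = evalW e a r}

/-- `cosetRel I a b` says that `b` lies in the coset `I · a`. -/
def cosetRel (I : Set A) (a b : A) : Prop := ∃ c ∈ I, b = dmul c a

/-- The class `I_n`: the maps `φ_m : (A/Ann_n(A))^{n+1} → A_{(n)}`,
`(Ann_n(A)a₁, …, Ann_n(A)a_{n+1}) ↦ m(a₁⋯a_{n+1})`, are well defined for every word `m` of
degree `n`. -/
def InClass (A : Type u) [SkewBrace A] (n : ℕ) : Prop :=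
  ∀ (e : ℕ → BWord) (a b : ℕ → A),
    (∀ i : ℕ, i ≤ n → cosetRel (AnnS A n) (a i) (b i)) →
    evalW e b n = evalW e a n

/-- A skew left brace `(A,·,∘)` is symmetric if `(A,∘,·)` is also a skew left brace, i.e.
`a · (b ∘ c) = (a · b) ∘ ā ∘ (a · c)`. -/
def IsSymmetric (A : Type u) [SkewBrace A] : Prop :=
  ∀ a b c : A, dmul a (cmul b c) = cmul (cmul (dmul a b) (cinv a)) (dmul a c)

/-- A sub-skew brace: a subset which is a subgroup of both `(A,·)` and `(A,∘)`. -/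
structure IsSubBrace (A : Type u) [SkewBrace A] (S : Set A) : Prop where
  ident_mem : ident ∈ S
  dmul_mem : ∀ {x y : A}, x ∈ S → y ∈ S → dmul x y ∈ S
  dinv_mem : ∀ {x : A}, x ∈ S → dinv x ∈ S
  cmul_mem : ∀ {x y : A}, x ∈ S → y ∈ S → cmul x y ∈ S
  cinv_mem : ∀ {x : A}, x ∈ S → cinv x ∈ S

/-- An ideal of a skew brace: a subgroup of `(A,·)`, normal in `(A,·)` and `(A,∘)`,
and invariant under all `λ_a`. -/
structure IsIdeal (A : Type u) [SkewBrace A] (I : Set A) : Prop where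
  ident_mem : ident ∈ I
  dmul_mem : ∀ {x y : A}, x ∈ I → y ∈ I → dmul x y ∈ I
  dinv_mem : ∀ {x : A}, x ∈ I → dinv x ∈ I
  dconj_mem : ∀ (a : A) {x : A}, x ∈ I → dmul (dmul a x) (dinv a) ∈ I
  cconj_mem : ∀ (a : A) {x : A}, x ∈ I → cmul (cmul a x) (cinv a) ∈ I
  lam_mem : ∀ (a : A) {x : A}, x ∈ I → lam a x ∈ I

/-- A homomorphism of skew braces. -/
structure IsBraceHom {A : Type u} {B : Type v} [SkewBrace A] [SkewBrace B] (f : A → B) : Prop where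
  map_dmul : ∀ x y : A, f (dmul x y) = dmul (f x) (f y)
  map_cmul : ∀ x y : A, f (cmul x y) = cmul (f x) (f y)

/-- The data of an isoclinism of skew braces along ideals `I` of `A` and `J` of `B`:
`ξ` induces a brace isomorphism `A/I → B/J` and `θ` restricts to a brace isomorphism
`Γ₂(A) → Γ₂(B)` compatible with the commutator and star maps. -/
structure IsoclinismData (A : Type u) (B : Type v) [SkewBrace A] [SkewBrace B]
    (I : Set A) (J : Set B) (ξ θ : A → B) : Prop where
  xi_resp : ∀ a a' : A, cosetRel I a a' ↔ cosetRel J (ξ a) (ξ a')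
  xi_surj : ∀ b : B, ∃ a : A, cosetRel J b (ξ a)
  xi_dmul : ∀ a a' : A, cosetRel J (dmul (ξ a) (ξ a')) (ξ (dmul a a'))
  xi_cmul : ∀ a a' : A, cosetRel J (cmul (ξ a) (ξ a')) (ξ (cmul a a'))
  theta_maps : ∀ x ∈ Gamma A 2, θ x ∈ Gamma B 2
  theta_inj : ∀ x ∈ Gamma A 2, ∀ y ∈ Gamma A 2, θ x = θ y → x = y
  theta_surj : ∀ y ∈ Gamma B 2, ∃ x ∈ Gamma A 2, θ x = y
  theta_dmul : ∀ x ∈ Gamma A 2, ∀ y ∈ Gamma A 2, θ (dmul x y) = dmul (θ x) (θ y)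
  theta_cmul : ∀ x ∈ Gamma A 2, ∀ y ∈ Gamma A 2, θ (cmul x y) = cmul (θ x) (θ y)
  compat_dcomm : ∀ a₁ a₂ : A, ∀ b₁ b₂ : B, cosetRel J b₁ (ξ a₁) → cosetRel J b₂ (ξ a₂) →
    θ (dcomm a₁ a₂) = dcomm b₁ b₂
  compat_star : ∀ a₁ a₂ : A, ∀ b₁ b₂ : B, cosetRel J b₁ (ξ a₁) → cosetRel J b₂ (ξ a₂) →
    θ (bstar a₁ a₂) = bstar b₁ b₂

/-- Isoclinism (1-isoclinism) of skew left braces. -/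
def Isoclinic (A : Type u) (B : Type v) [SkewBrace A] [SkewBrace B] : Prop :=
  ∃ ξ θ : A → B, IsoclinismData A B (AnnS A 1) (AnnS B 1) ξ θ

/-- The data of an `n`-isoclinism of skew braces: `ξ` induces a brace isomorphism
`A/Ann_n(A) → B/Ann_n(B)` and `θ` restricts to a brace isomorphism `A_{(n)} → B_{(n)}`
commuting with all brace commutator word maps of degree `n`. -/
structure IsoclinismDataN (A : Type u) (B : Type v) [SkewBrace A] [SkewBrace B]
    (n : ℕ) (ξ θ : A → B) : Prop where
  xi_resp : ∀ a a' : A, cosetRel (AnnS A n) a a' ↔ cosetRel (AnnS B n) (ξ a) (ξ a')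
  xi_surj : ∀ b : B, ∃ a : A, cosetRel (AnnS B n) b (ξ a)
  xi_dmul : ∀ a a' : A, cosetRel (AnnS B n) (dmul (ξ a) (ξ a')) (ξ (dmul a a'))
  xi_cmul : ∀ a a' : A, cosetRel (AnnS B n) (cmul (ξ a) (ξ a')) (ξ (cmul a a'))
  theta_maps : ∀ x ∈ Asub A n, θ x ∈ Asub B n
  theta_inj : ∀ x ∈ Asub A n, ∀ y ∈ Asub A n, θ x = θ y → x = y
  theta_surj : ∀ y ∈ Asub B n, ∃ x ∈ Asub A n, θ x = y
  theta_dmul : ∀ x ∈ Asub A n, ∀ y ∈ Asub A n, θ (dmul x y) = dmul (θ x) (θ y)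
  theta_cmul : ∀ x ∈ Asub A n, ∀ y ∈ Asub A n, θ (cmul x y) = cmul (θ x) (θ y)
  compat : ∀ (e : ℕ → BWord) (a : ℕ → A) (b : ℕ → B),
    (∀ i : ℕ, i ≤ n → cosetRel (AnnS B n) (b i) (ξ (a i))) →
    θ (evalW e a n) = evalW e b n

/-- `n`-isoclinism of skew left braces. -/
def IsoclinicN (A : Type u) (B : Type v) [SkewBrace A] [SkewBrace B] (n : ℕ) : Prop :=
  ∃ ξ θ : A → B, IsoclinismDataN A B n ξ θ

/-- The product set `S · T = {s · t : s ∈ S, t ∈ T}` in `(A,·)`. -/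
def setDProd (S T : Set A) : Set A := {x | ∃ s ∈ S, ∃ t ∈ T, x = dmul s t}

/-- The product set `S ∘ T = {s ∘ t : s ∈ S, t ∈ T}` in `(A,∘)`. -/
def setCProd (S T : Set A) : Set A := {x | ∃ s ∈ S, ∃ t ∈ T, x = cmul s t}

/-- The skew brace structure on a sub-skew brace. -/
def subBrace (S : Set A) (h : IsSubBrace A S) : SkewBrace S where
  dmul x y := ⟨dmul x.1 y.1, h.dmul_mem x.2 y.2⟩
  ident := ⟨ident, h.ident_mem⟩
  dinv x := ⟨dinv x.1, h.dinv_mem x.2⟩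
  cmul x y := ⟨cmul x.1 y.1, h.cmul_mem x.2 y.2⟩
  cinv x := ⟨cinv x.1, h.cinv_mem x.2⟩
  dmul_assoc a b c := Subtype.ext (dmul_assoc a.1 b.1 c.1)
  ident_dmul a := Subtype.ext (ident_dmul a.1)
  dmul_ident a := Subtype.ext (dmul_ident a.1)
  dinv_dmul a := Subtype.ext (dinv_dmul a.1)
  dmul_dinv a := Subtype.ext (dmul_dinv a.1)
  cmul_assoc a b c := Subtype.ext (cmul_assoc a.1 b.1 c.1)
  ident_cmul a := Subtype.ext (ident_cmul a.1)
  cmul_ident a := Subtype.ext (cmul_ident a.1)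
  cinv_cmul a := Subtype.ext (cinv_cmul a.1)
  cmul_cinv a := Subtype.ext (cmul_cinv a.1)
  compat a b c := Subtype.ext (compat a.1 b.1 c.1)

/-- The direct product of two skew braces, with componentwise operations. -/
instance prodBrace (A : Type u) (B : Type v) [SkewBrace A] [SkewBrace B] :
    SkewBrace (A × B) where
  dmul p q := (dmul p.1 q.1, dmul p.2 q.2)
  ident := (ident, ident)
  dinv p := (dinv p.1, dinv p.2)
  cmul p q := (cmul p.1 q.1, cmul p.2 q.2)
  cinv p := (cinv p.1, cinv p.2)
  dmul_assoc a b c := Prod.ext_iff.mpr ⟨dmul_assoc _ _ _, dmul_assoc _ _ _⟩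
  ident_dmul a := Prod.ext_iff.mpr ⟨ident_dmul _, ident_dmul _⟩
  dmul_ident a := Prod.ext_iff.mpr ⟨dmul_ident _, dmul_ident _⟩
  dinv_dmul a := Prod.ext_iff.mpr ⟨dinv_dmul _, dinv_dmul _⟩
  dmul_dinv a := Prod.ext_iff.mpr ⟨dmul_dinv _, dmul_dinv _⟩
  cmul_assoc a b c := Prod.ext_iff.mpr ⟨cmul_assoc _ _ _, cmul_assoc _ _ _⟩
  ident_cmul a := Prod.ext_iff.mpr ⟨ident_cmul _, ident_cmul _⟩
  cmul_ident a := Prod.ext_iff.mpr ⟨cmul_ident _, cmul_ident _⟩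
  cinv_cmul a := Prod.ext_iff.mpr ⟨cinv_cmul _, cinv_cmul _⟩
  cmul_cinv a := Prod.ext_iff.mpr ⟨cmul_cinv _, cmul_cinv _⟩
  compat a b c := Prod.ext_iff.mpr ⟨compat _ _ _, compat _ _ _⟩

end SkewBrace

section CentralSeries

variable {G : Type*} [Group G]

open scoped commutatorElement

/-- The three subgroups lemma modulo a normal subgroup. -/
theorem commutator_commutator_le_of_rotate (N : Subgroup G) [N.Normal] {H₁ H₂ H₃ : Subgroup G}
    (h1 : ⁅⁅H₂, H₃⁆, H₁⁆ ≤ N) (h2 : ⁅⁅H₃, H₁⁆, H₂⁆ ≤ N) : ⁅⁅H₁, H₂⁆, H₃⁆ ≤ N := by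
  have key : ∀ K : Subgroup G, K ≤ N ↔ K.map (QuotientGroup.mk' N) = ⊥ := fun K => by
    rw [Subgroup.map_eq_bot_iff, QuotientGroup.ker_mk']
  rw [key, Subgroup.map_commutator, Subgroup.map_commutator] at h1 h2 ⊢
  exact Subgroup.commutator_commutator_eq_bot_of_rotate h1 h2

theorem commutator_upperCentralSeries_lowerCentralSeries_le (k m : ℕ) :
    ⁅Subgroup.upperCentralSeries G (m + k + 1), (⊤ : Subgroup G).lowerCentralSeries k⁆ ≤
      Subgroup.upperCentralSeries G m := by
  induction k generalizing m with
  | zero => exact Subgroup.commutator_upperCentralSeries_top_le G m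
  | succ k ih =>
    rw [Subgroup.lowerCentralSeries_succ, Subgroup.commutator_comm]
    refine commutator_commutator_le_of_rotate _ ?_ ?_
    · rw [Subgroup.commutator_comm ⊤]
      exact (Subgroup.commutator_mono (Subgroup.commutator_upperCentralSeries_top_le G _) le_rfl).trans (ih m)
    · refine (Subgroup.commutator_mono ?_ le_rfl).trans (Subgroup.commutator_upperCentralSeries_top_le G m)
      have := ih (m + 1)
      rwa [show m + 1 + k + 1 = m + (k + 1) + 1 by ring] at this

/-- If `a' ≡ a` modulo `Z_{m+k+1}(G)`, `x' ≡ x` modulo `Z_{m+1}(G)` and `x` lies in the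
`k`-th term of the lower central series, then `[a', x'] ≡ [a, x]` modulo `Z_m(G)`. -/
theorem mk_commutatorElement_eq {k m : ℕ} {a a' x x' : G}
    (ha : (a' : G ⧸ Subgroup.upperCentralSeries G (m + k + 1)) = a)
    (hx : (x' : G ⧸ Subgroup.upperCentralSeries G (m + 1)) = x)
    (hxk : x ∈ (⊤ : Subgroup G).lowerCentralSeries k) :
    ((⁅a', x'⁆ : G) : G ⧸ Subgroup.upperCentralSeries G m) = (⁅a, x⁆ : G) := by
  obtain ⟨z, hz, rfl⟩ : ∃ z ∈ Subgroup.upperCentralSeries G (m + k + 1), a' = a * z :=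
    ⟨a⁻¹ * a', QuotientGroup.eq.1 ha.symm, by group⟩
  obtain ⟨u, hu, rfl⟩ : ∃ u ∈ Subgroup.upperCentralSeries G (m + 1), x' = x * u :=
    ⟨x⁻¹ * x', QuotientGroup.eq.1 hx.symm, by group⟩
  have hzx : ⁅z, x⁆ ∈ Subgroup.upperCentralSeries G m :=
    commutator_upperCentralSeries_lowerCentralSeries_le k m (Subgroup.commutator_mem_commutator hz hxk)
  have hu' : ∀ g : G, ⁅u, g⁆ ∈ Subgroup.upperCentralSeries G m := Subgroup.mem_upperCentralSeries_succ_iff.1 hu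
  have comm : ∀ {g h : G}, ⁅g, h⁆ ∈ Subgroup.upperCentralSeries G m →
      (g : G ⧸ Subgroup.upperCentralSeries G m) * h = h * g := by
    intro g h hgh
    rw [← QuotientGroup.eq_one_iff] at hgh
    exact commutatorElement_eq_one_iff_mul_comm.1 hgh
  have c1 := comm hzx
  have c2 := comm (hu' (a * z))
  have c3 := comm (hu' a)
  simp only [commutatorElement_def, QuotientGroup.mk_mul, QuotientGroup.mk_inv] at c2 ⊢
  generalize (a : G ⧸ Subgroup.upperCentralSeries G m) = a at *
  generalize (z : G ⧸ Subgroup.upperCentralSeries G m) = z at *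
  generalize (x : G ⧸ Subgroup.upperCentralSeries G m) = x at *
  generalize (u : G ⧸ Subgroup.upperCentralSeries G m) = u at *
  calc a * z * (x * u) * (a * z)⁻¹ * (x * u)⁻¹
      = a * z * x * (u * (a * z)⁻¹) * u⁻¹ * x⁻¹ := by group
    _ = a * z * x * ((a * z)⁻¹ * u) * u⁻¹ * x⁻¹ := by
        rw [(show Commute u (a * z) from c2).inv_right.eq]
    _ = a * (z * x) * z⁻¹ * a⁻¹ * x⁻¹ := by group
    _ = a * x * a⁻¹ * x⁻¹ := by rw [c1]; group

theorem mk_commutatorElement_eq' {k m : ℕ} {a a' x x' : G}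
    (ha : (a' : G ⧸ Subgroup.upperCentralSeries G (m + k + 1)) = a)
    (hx : (x' : G ⧸ Subgroup.upperCentralSeries G (m + 1)) = x)
    (hxk : x ∈ (⊤ : Subgroup G).lowerCentralSeries k) :
    ((⁅x', a'⁆ : G) : G ⧸ Subgroup.upperCentralSeries G m) = (⁅x, a⁆ : G) := by
  rw [← commutatorElement_inv a', ← commutatorElement_inv a, QuotientGroup.mk_inv,
    QuotientGroup.mk_inv, mk_commutatorElement_eq ha hx hxk]

end CentralSeries

namespace SkewBrace

section Representation

open scoped commutatorElement

variable {A : Type u} [SkewBrace A]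

/-- A pair of maps `L, R : A → H` turning the group commutators and the star operation of `A`
into commutators of a group `H` generated by the images of `L` and `R`. -/
structure CommRep (A : Type u) [SkewBrace A] (H : Type v) [Group H] where
  L : A → H
  R : A → H
  L_dmul : ∀ a b : A, L (dmul a b) = L a * L b
  R_dmul : ∀ a b : A, R (dmul a b) = R a * R b
  eq_ident_of_L : ∀ a : A, L a = 1 → a = ident
  L_bstar : ∀ a b : A, L (bstar a b) = ⁅(R a)⁻¹, L b⁆
  R_bstar : ∀ a b : A, R (bstar a b) = ⁅(R a)⁻¹, R b⁆
  gen : ∀ K : Subgroup H, (∀ a, L a ∈ K) → (∀ a, R a ∈ K) → ∀ h, h ∈ K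

/-- The group `(A,·)`. -/
abbrev dotGroup (A : Type u) [SkewBrace A] : Group A where
  mul := dmul
  one := ident
  inv := dinv
  mul_assoc := dmul_assoc
  one_mul := ident_dmul
  mul_one := dmul_ident
  inv_mul_cancel := dinv_dmul

attribute [local instance] dotGroup

theorem dmul_eq_mul (a b : A) : dmul a b = a * b := rfl

theorem dinv_eq_inv (a : A) : dinv a = a⁻¹ := rfl

theorem ident_eq_one : (ident : A) = 1 := rfl

theorem cmul_eq_mul_lam (a b : A) : cmul a b = a * lam a b := by
  simp only [lam, dmul_eq_mul, dinv_eq_inv]; group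

theorem lam_mul (a b c : A) : lam a (b * c) = lam a b * lam a c := by
  have := compat a b c
  simp only [dmul_eq_mul, dinv_eq_inv] at this
  simp only [lam, dmul_eq_mul, dinv_eq_inv, this]; group

theorem lam_cmul (a b c : A) : lam (cmul a b) c = lam a (lam b c) := by
  have h := cmul_assoc a b c
  rw [cmul_eq_mul_lam b c, cmul_eq_mul_lam a (b * _), lam_mul, cmul_eq_mul_lam (cmul a b),
    ← mul_assoc, ← cmul_eq_mul_lam a b] at h
  exact mul_left_cancel h

theorem lam_ident (a : A) : lam ident a = a := by
  rw [lam, ident_cmul, dmul_eq_mul, dinv_eq_inv, ident_eq_one, inv_one, one_mul]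

/-- The automorphism `λ_a` of `(A,·)`. -/
def lamAut (a : A) : MulAut A where
  toFun := lam a
  invFun := lam (cinv a)
  left_inv b := by rw [← lam_cmul, cinv_cmul, lam_ident]
  right_inv b := by rw [← lam_cmul, cmul_cinv, lam_ident]
  map_mul' := lam_mul a

theorem lamAut_cmul (a b : A) : lamAut (cmul a b) = lamAut a * lamAut b :=
  MulEquiv.ext (lam_cmul a b)

/-- In a symmetric skew brace `λ` is an antihomomorphism on `(A,·)`. -/
theorem lamAut_mul (hA : IsSymmetric A) (a b : A) : lamAut (a * b) = lamAut b * lamAut a := by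
  refine MulEquiv.ext fun d => ?_
  have h := hA a b (lam a d)
  rw [cmul_assoc, dmul_eq_mul a (lam a d), ← cmul_eq_mul_lam, ← cmul_assoc (cinv a), cinv_cmul,
    ident_cmul, cmul_eq_mul_lam, cmul_eq_mul_lam, dmul_eq_mul, dmul_eq_mul, mul_assoc] at h
  exact (mul_left_cancel (mul_left_cancel h)).symm

/-- The homomorphism `a ↦ λ_a⁻¹` from `(A,·)` to its automorphism group. -/
def lamInvHom (hA : IsSymmetric A) : A →* MulAut A :=
  MonoidHom.mk' (fun a => (lamAut a)⁻¹) fun a b => by rw [lamAut_mul hA, mul_inv_rev]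

theorem lamInvHom_lam (hA : IsSymmetric A) (a b : A) :
    lamInvHom hA (lam a b) = (lamInvHom hA a)⁻¹ * lamInvHom hA b * lamInvHom hA a := by
  have h := lamAut_cmul a b
  rw [cmul_eq_mul_lam, lamAut_mul hA] at h
  change (lamAut (lam a b))⁻¹ = (lamAut a)⁻¹⁻¹ * (lamAut b)⁻¹ * (lamAut a)⁻¹
  rw [← eq_mul_inv_iff_mul_eq] at h
  rw [h]; group

theorem exists_commRep (hA : IsSymmetric A) :
    ∃ (H : Type u) (_ : Group H), Nonempty (CommRep A H) := by
  let ρ := lamInvHom hA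
  let R : A →* A ⋊[ρ.range.subtype] ρ.range := SemidirectProduct.inr.comp ρ.rangeRestrict
  refine ⟨A ⋊[ρ.range.subtype] ρ.range, inferInstance,
    ⟨⟨SemidirectProduct.inl, R, map_mul _, map_mul R, ?_, ?_, ?_, ?_⟩⟩⟩
  · intro a h
    exact SemidirectProduct.inl_injective (h.trans (map_one _).symm)
  · intro a b
    have h := SemidirectProduct.inl_aut (φ := ρ.range.subtype) (ρ.rangeRestrict a)⁻¹ b
    have hl : ρ.range.subtype (ρ.rangeRestrict a)⁻¹ b = lam a b := by
      change ((lamAut a)⁻¹)⁻¹ b = _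
      rw [inv_inv]; rfl
    rw [hl] at h
    rw [bstar, dmul_eq_mul, dinv_eq_inv, map_mul, h, inv_inv, map_inv, map_inv,
      commutatorElement_def, inv_inv]
    rfl
  · intro a b
    rw [bstar, dmul_eq_mul, dinv_eq_inv, map_mul, map_inv, commutatorElement_def, inv_inv,
      ← map_inv R a, ← map_mul, ← map_mul]
    congr 1
    refine congrArg SemidirectProduct.inr (Subtype.ext ?_)
    change ρ (lam a b) = ρ (a⁻¹ * b * a)
    rw [lamInvHom_lam hA, map_mul, map_mul, map_inv]
  · intro K hL hR h
    rw [← SemidirectProduct.inl_left_mul_inr_right h]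
    refine K.mul_mem (hL _) ?_
    obtain ⟨a, ha⟩ := ρ.rangeRestrict_surjective h.right
    rw [← ha]
    exact hR a

namespace CommRep

variable {H : Type v} [Group H] (M : CommRep A H)

theorem L_ident : M.L ident = 1 := by
  have := M.L_dmul ident ident
  rwa [ident_dmul, left_eq_mul] at this

theorem R_ident : M.R ident = 1 := by
  have := M.R_dmul ident ident
  rwa [ident_dmul, left_eq_mul] at this

theorem L_dinv (a : A) : M.L (dinv a) = (M.L a)⁻¹ := by
  rw [eq_inv_iff_mul_eq_one, ← M.L_dmul, dinv_dmul, M.L_ident]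

theorem R_dinv (a : A) : M.R (dinv a) = (M.R a)⁻¹ := by
  rw [eq_inv_iff_mul_eq_one, ← M.R_dmul, dinv_dmul, M.R_ident]

theorem L_dcomm (a b : A) : M.L (dcomm a b) = ⁅M.L a, M.L b⁆ := by
  simp only [dcomm, M.L_dmul, M.L_dinv, commutatorElement_def]

theorem R_dcomm (a b : A) : M.R (dcomm a b) = ⁅M.R a, M.R b⁆ := by
  simp only [dcomm, M.R_dmul, M.R_dinv, commutatorElement_def]

theorem commutatorElement_mem_iff {N : Subgroup H} [N.Normal] {g h : H} :
    ⁅g, h⁆ ∈ N ↔ Commute (g : H ⧸ N) h := by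
  rw [← QuotientGroup.eq_one_iff]
  exact commutatorElement_eq_one_iff_commute (g₁ := (g : H ⧸ N)) (g₂ := (h : H ⧸ N))

theorem mem_upperCentralSeries_succ {k : ℕ} {y : H}
    (hL : ∀ a, Commute (y : H ⧸ Subgroup.upperCentralSeries H k) (M.L a : H))
    (hR : ∀ a, Commute (y : H ⧸ Subgroup.upperCentralSeries H k) (M.R a : H)) :
    y ∈ Subgroup.upperCentralSeries H (k + 1) := by
  refine Subgroup.mem_upperCentralSeries_succ_iff.2 fun h => commutatorElement_mem_iff.2 ?_
  have key := M.gen ((Subgroup.centralizer {(y : H ⧸ Subgroup.upperCentralSeries H k)}).comap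
    (QuotientGroup.mk' _))
    (fun a => Subgroup.mem_centralizer_singleton_iff.2 (hL a).symm)
    (fun a => Subgroup.mem_centralizer_singleton_iff.2 (hR a).symm) h
  exact Commute.symm (Subgroup.mem_centralizer_singleton_iff.1 key)

theorem mem_AnnS_iff {k : ℕ} {x : A} :
    x ∈ AnnS A k ↔ M.L x ∈ Subgroup.upperCentralSeries H k ∧
      M.R x ∈ Subgroup.upperCentralSeries H k := by
  induction k generalizing x with
  | zero =>
    constructor
    · intro hx
      obtain rfl : x = ident := hx
      simp [M.L_ident, M.R_ident]
    · rintro ⟨h, -⟩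
      exact M.eq_ident_of_L x (by simpa using h)
  | succ k ih =>
    have hu : x ∈ AnnS A (k + 1) ↔ ∀ b : A, bstar x b ∈ AnnS A k ∧ bstar b x ∈ AnnS A k ∧
      dcomm x b ∈ AnnS A k := Iff.rfl
    simp only [hu, ih, M.L_bstar, M.R_bstar, M.L_dcomm, M.R_dcomm, commutatorElement_mem_iff,
      QuotientGroup.mk_inv, Commute.inv_left_iff]
    constructor
    · intro h
      exact ⟨M.mem_upperCentralSeries_succ (fun a => (h a).2.2.1) fun a => (h a).2.1.1.symm,
        M.mem_upperCentralSeries_succ (fun a => (h a).1.1) fun a => (h a).1.2⟩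
    · rintro ⟨hL, hR⟩ b
      have hL' := fun y => commutatorElement_mem_iff.1
        (Subgroup.mem_upperCentralSeries_succ_iff.1 hL y)
      have hR' := fun y => commutatorElement_mem_iff.1
        (Subgroup.mem_upperCentralSeries_succ_iff.1 hR y)
      exact ⟨⟨hR' _, hR' _⟩, ⟨(hL' _).symm, (hR' _).symm⟩, hL' _, hR' _⟩

/-- Congruence of elements of `A` modulo the `k`-th term of the upper central series of `H`. -/
def Rel (k : ℕ) (a b : A) : Prop :=
  (M.L a : H ⧸ Subgroup.upperCentralSeries H k) = M.L b ∧
    (M.R a : H ⧸ Subgroup.upperCentralSeries H k) = M.R b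

theorem cosetRel_iff {k : ℕ} {a b : A} : cosetRel (AnnS A k) a b ↔ M.Rel k a b := by
  constructor
  · rintro ⟨c, hc, rfl⟩
    rw [M.mem_AnnS_iff, ← QuotientGroup.eq_one_iff, ← QuotientGroup.eq_one_iff] at hc
    simp only [Rel, M.L_dmul, M.R_dmul, QuotientGroup.mk_mul, hc.1, hc.2, one_mul, and_self]
  · intro h
    refine ⟨dmul b (dinv a), ?_, by rw [dmul_assoc, dinv_dmul, dmul_ident]⟩
    rw [M.mem_AnnS_iff, ← QuotientGroup.eq_one_iff, ← QuotientGroup.eq_one_iff]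
    simp only [M.L_dmul, M.R_dmul, M.L_dinv, M.R_dinv, QuotientGroup.mk_mul, QuotientGroup.mk_inv,
      h.1, h.2, mul_inv_cancel, and_self]

theorem Rel.dmul {M : CommRep A H} {k : ℕ} {a a' b b' : A} (ha : M.Rel k a a')
    (hb : M.Rel k b b') : M.Rel k (dmul a b) (SkewBrace.dmul a' b') := by
  simp only [Rel, M.L_dmul, M.R_dmul, QuotientGroup.mk_mul, ha.1, ha.2, hb.1, hb.2, and_self]

theorem Rel.bstar {M : CommRep A H} {k : ℕ} {a a' b b' : A} (ha : M.Rel k a a')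
    (hb : M.Rel k b b') : M.Rel k (bstar a b) (SkewBrace.bstar a' b') := by
  simp only [Rel, M.L_bstar, M.R_bstar, commutatorElement_def, QuotientGroup.mk_mul,
    QuotientGroup.mk_inv, ha.2, hb.1, hb.2, and_self]

theorem Rel.dinv {M : CommRep A H} {k : ℕ} {a a' : A} (ha : M.Rel k a a') :
    M.Rel k (dinv a) (SkewBrace.dinv a') := by
  simp only [Rel, M.L_dinv, M.R_dinv, QuotientGroup.mk_inv, ha.1, ha.2, and_self]

theorem evalX_mem {k : ℕ} (e : BWord) (a : A) {x : A}
    (hL : M.L x ∈ (⊤ : Subgroup H).lowerCentralSeries k)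
    (hR : M.R x ∈ (⊤ : Subgroup H).lowerCentralSeries k) :
    M.L (evalX e a x) ∈ (⊤ : Subgroup H).lowerCentralSeries (k + 1) ∧
      M.R (evalX e a x) ∈ (⊤ : Subgroup H).lowerCentralSeries (k + 1) := by
  have h1 : ∀ {g h : H}, g ∈ (⊤ : Subgroup H).lowerCentralSeries k →
      ⁅g, h⁆ ∈ (⊤ : Subgroup H).lowerCentralSeries (k + 1) := fun hg =>
    Subgroup.commutator_mem_commutator hg (Subgroup.mem_top _)
  have h2 : ∀ {g h : H}, g ∈ (⊤ : Subgroup H).lowerCentralSeries k →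
      ⁅h, g⁆ ∈ (⊤ : Subgroup H).lowerCentralSeries (k + 1) := fun hg => by
    rw [← commutatorElement_inv]; exact inv_mem (h1 hg)
  cases e <;> simp only [evalX, M.L_bstar, M.R_bstar, M.L_dcomm, M.R_dcomm]
  · exact ⟨h2 hL, h2 hR⟩
  · exact ⟨h1 hL, h1 hR⟩
  · exact ⟨h2 hL, h2 hR⟩
  · exact ⟨h1 (inv_mem hR), h1 (inv_mem hR)⟩

theorem evalW_mem (e : ℕ → BWord) (a : ℕ → A) (k : ℕ) :
    M.L (evalW e a k) ∈ (⊤ : Subgroup H).lowerCentralSeries k ∧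
      M.R (evalW e a k) ∈ (⊤ : Subgroup H).lowerCentralSeries k := by
  induction k generalizing e a with
  | zero => exact ⟨Subgroup.mem_top _, Subgroup.mem_top _⟩
  | succ k ih => exact M.evalX_mem _ _ (ih _ _).1 (ih _ _).2

theorem evalX_rel {k m : ℕ} (e : BWord) {a a' x x' : A} (ha : M.Rel (m + k + 1) a' a)
    (hx : M.Rel (m + 1) x' x) (hL : M.L x ∈ (⊤ : Subgroup H).lowerCentralSeries k)
    (hR : M.R x ∈ (⊤ : Subgroup H).lowerCentralSeries k) :
    M.Rel m (evalX e a' x') (evalX e a x) := by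
  have hai : (((M.R a')⁻¹ : H) : H ⧸ Subgroup.upperCentralSeries H (m + k + 1)) =
      ((M.R a)⁻¹ : H) := by rw [QuotientGroup.mk_inv, ha.2, QuotientGroup.mk_inv]
  have hxi : (((M.R x')⁻¹ : H) : H ⧸ Subgroup.upperCentralSeries H (m + 1)) =
      ((M.R x)⁻¹ : H) := by rw [QuotientGroup.mk_inv, hx.2, QuotientGroup.mk_inv]
  cases e <;> simp only [Rel, evalX, M.L_bstar, M.R_bstar, M.L_dcomm, M.R_dcomm]
  · exact ⟨mk_commutatorElement_eq ha.1 hx.1 hL, mk_commutatorElement_eq ha.2 hx.2 hR⟩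
  · exact ⟨mk_commutatorElement_eq' ha.1 hx.1 hL, mk_commutatorElement_eq' ha.2 hx.2 hR⟩
  · exact ⟨mk_commutatorElement_eq hai hx.1 hL, mk_commutatorElement_eq hai hx.2 hR⟩
  · exact ⟨mk_commutatorElement_eq' ha.1 hxi (inv_mem hR),
      mk_commutatorElement_eq' ha.2 hxi (inv_mem hR)⟩

theorem evalW_rel {k m : ℕ} (e : ℕ → BWord) {a b : ℕ → A}
    (h : ∀ i ≤ k, M.Rel (m + k) (b i) (a i)) : M.Rel m (evalW e b k) (evalW e a k) := by
  induction k generalizing e a b m with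
  | zero => exact h 0 le_rfl
  | succ k ih =>
    have hm := M.evalW_mem (fun i => e (i + 1)) (fun i => a (i + 1)) k
    refine M.evalX_rel _ (h 0 (Nat.zero_le _)) (ih _ fun i hi => ?_) hm.1 hm.2
    have := h (i + 1) (Nat.succ_le_succ hi)
    rwa [show m + 1 + k = m + (k + 1) by ring]

end CommRep

end Representation

section Congruence

variable {A : Type u} [SkewBrace A]

/-- A symmetric skew brace lies in the class `I_n` for every `n`. -/
theorem IsSymmetric.inClass (hA : IsSymmetric A) (n : ℕ) : InClass A n := by
  obtain ⟨H, _, ⟨M⟩⟩ := exists_commRep hA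
  intro e a b h
  have hr := M.evalW_rel (m := 0) e (a := b) (b := a) (k := n) fun i hi => by
    rw [Nat.zero_add]; exact M.cosetRel_iff.1 (h i hi)
  obtain ⟨c, hc, h⟩ := M.cosetRel_iff.2 hr
  obtain rfl : c = ident := hc
  rw [h, ident_dmul]

theorem cosetRel_refl (n : ℕ) (hA : IsSymmetric A) (a : A) : cosetRel (AnnS A n) a a := by
  obtain ⟨H, _, ⟨M⟩⟩ := exists_commRep hA
  exact M.cosetRel_iff.2 ⟨rfl, rfl⟩

theorem cosetRel_symm {n : ℕ} (hA : IsSymmetric A) {a b : A} (h : cosetRel (AnnS A n) a b) :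
    cosetRel (AnnS A n) b a := by
  obtain ⟨H, _, ⟨M⟩⟩ := exists_commRep hA
  rw [M.cosetRel_iff] at *
  exact ⟨h.1.symm, h.2.symm⟩

theorem cosetRel_trans {n : ℕ} (hA : IsSymmetric A) {a b c : A} (h : cosetRel (AnnS A n) a b)
    (h' : cosetRel (AnnS A n) b c) : cosetRel (AnnS A n) a c := by
  obtain ⟨H, _, ⟨M⟩⟩ := exists_commRep hA
  rw [M.cosetRel_iff] at *
  exact ⟨h.1.trans h'.1, h.2.trans h'.2⟩

theorem cosetRel_dmul {n : ℕ} (hA : IsSymmetric A) {a a' b b' : A}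
    (ha : cosetRel (AnnS A n) a a') (hb : cosetRel (AnnS A n) b b') :
    cosetRel (AnnS A n) (dmul a b) (dmul a' b') := by
  obtain ⟨H, _, ⟨M⟩⟩ := exists_commRep hA
  rw [M.cosetRel_iff] at *
  exact ha.dmul hb

theorem cosetRel_dinv {n : ℕ} (hA : IsSymmetric A) {a a' : A}
    (ha : cosetRel (AnnS A n) a a') : cosetRel (AnnS A n) (dinv a) (dinv a') := by
  obtain ⟨H, _, ⟨M⟩⟩ := exists_commRep hA
  rw [M.cosetRel_iff] at *
  exact ha.dinv

theorem cmul_eq_dmul_bstar (a b : A) : cmul a b = dmul (dmul a (bstar a b)) b := by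
  simp only [bstar, lam, dmul_assoc, dinv_dmul, dmul_ident]
  rw [← dmul_assoc, dmul_dinv, ident_dmul]

theorem cosetRel_cmul {n : ℕ} (hA : IsSymmetric A) {a a' b b' : A}
    (ha : cosetRel (AnnS A n) a a') (hb : cosetRel (AnnS A n) b b') :
    cosetRel (AnnS A n) (cmul a b) (cmul a' b') := by
  obtain ⟨H, _, ⟨M⟩⟩ := exists_commRep hA
  rw [M.cosetRel_iff] at *
  rw [cmul_eq_dmul_bstar, cmul_eq_dmul_bstar]
  exact (ha.dmul (ha.bstar hb)).dmul hb

theorem cosetRel_cinv {n : ℕ} (hA : IsSymmetric A) {a a' : A}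
    (ha : cosetRel (AnnS A n) a a') : cosetRel (AnnS A n) (cinv a) (cinv a') := by
  have h := cosetRel_cmul hA (cosetRel_cmul hA (cosetRel_refl n hA (cinv a))
    (cosetRel_symm hA ha)) (cosetRel_refl n hA (cinv a'))
  rw [cinv_cmul, ident_cmul, cmul_assoc, cmul_cinv, cmul_ident] at h
  exact h

theorem mem_setDProd_iff {n : ℕ} (hA : IsSymmetric A) {S : Set A} {x : A} :
    x ∈ setDProd S (AnnS A n) ↔ ∃ s ∈ S, cosetRel (AnnS A n) s x := by
  have hT : ∀ t : A, t ∈ AnnS A n ↔ cosetRel (AnnS A n) ident t := fun t =>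
    ⟨fun ht => ⟨t, ht, (dmul_ident t).symm⟩, fun ⟨c, hc, h⟩ => by
      rwa [h, dmul_ident]⟩
  constructor
  · rintro ⟨s, hs, t, ht, rfl⟩
    refine ⟨s, hs, ?_⟩
    have := cosetRel_dmul hA (cosetRel_refl n hA s) ((hT t).1 ht)
    rwa [dmul_ident] at this
  · rintro ⟨s, hs, h⟩
    refine ⟨s, hs, dmul (dinv s) x, (hT _).2 ?_, by rw [← dmul_assoc, dmul_dinv, ident_dmul]⟩
    have := cosetRel_dmul hA (cosetRel_refl n hA (dinv s)) h
    rwa [dinv_dmul] at this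

theorem isSubBrace_setDProd {n : ℕ} (hA : IsSymmetric A) {S : Set A} (hS : IsSubBrace A S) :
    IsSubBrace A (setDProd S (AnnS A n)) := by
  constructor <;> simp only [mem_setDProd_iff hA]
  · exact ⟨ident, hS.ident_mem, cosetRel_refl n hA _⟩
  · rintro x y ⟨s, hs, h⟩ ⟨t, ht, h'⟩
    exact ⟨_, hS.dmul_mem hs ht, cosetRel_dmul hA h h'⟩
  · rintro x ⟨s, hs, h⟩
    exact ⟨_, hS.dinv_mem hs, cosetRel_dinv hA h⟩
  · rintro x y ⟨s, hs, h⟩ ⟨t, ht, h'⟩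
    exact ⟨_, hS.cmul_mem hs ht, cosetRel_cmul hA h h'⟩
  · rintro x ⟨s, hs, h⟩
    exact ⟨_, hS.cinv_mem hs, cosetRel_cinv hA h⟩

end Congruence

section Words

variable {A : Type u} [SkewBrace A]

theorem evalW_congr {e e' : ℕ → BWord} {a a' : ℕ → A} {n : ℕ} (he : ∀ i < n, e i = e' i)
    (ha : ∀ i ≤ n, a i = a' i) : evalW e a n = evalW e' a' n := by
  induction n generalizing e e' a a' with
  | zero => exact ha 0 le_rfl
  | succ n ih =>
    simp only [evalW, he 0 (Nat.succ_pos n), ha 0 (Nat.zero_le _)]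
    rw [ih (fun i hi => he _ (Nat.succ_lt_succ hi)) fun i hi => ha _ (Nat.succ_le_succ hi)]

/-- A word of degree `n + k` is a word of degree `n` whose last argument is the value of a word
of degree `k`. -/
theorem evalW_add (e : ℕ → BWord) (a : ℕ → A) (n k : ℕ) :
    evalW e a (n + k) = evalW e
      (fun i => if i < n then a i else evalW (fun j => e (n + j)) (fun j => a (n + j)) k) n := by
  induction n generalizing e a with
  | zero => simp [evalW]
  | succ n ih =>
    rw [Nat.add_right_comm]
    simp only [evalW, ih, Nat.add_lt_add_iff_right, Nat.zero_lt_succ, if_true,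
      Nat.add_right_comm n 1]

theorem dinv_mem_AnnS (hA : IsSymmetric A) {n : ℕ} {x : A} (hx : x ∈ AnnS A n) :
    dinv x ∈ AnnS A n := by
  obtain ⟨H, _, ⟨M⟩⟩ := exists_commRep hA
  rw [M.mem_AnnS_iff] at *
  rw [M.L_dinv, M.R_dinv]
  exact ⟨inv_mem hx.1, inv_mem hx.2⟩

theorem dinv_dcomm (a b : A) : dinv (dcomm a b) = dcomm b a := by
  let _ := dotGroup A
  change (a * b * a⁻¹ * b⁻¹)⁻¹ = b * a * b⁻¹ * a⁻¹
  group

theorem evalX_mem_AnnS (hA : IsSymmetric A) {n : ℕ} {x : A} (hx : x ∈ AnnS A (n + 1))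
    (e : BWord) (b : A) : evalX e b x ∈ AnnS A n := by
  cases e
  · rw [evalX, ← dinv_dcomm]
    exact dinv_mem_AnnS hA (hx b).2.2
  · exact (hx b).2.2
  · exact (hx b).2.1
  · exact (hx b).1

/-- The `n`-th annihilator consists of the elements killed by all words of degree `n` when
inserted as last argument. -/
theorem mem_AnnS_iff_evalW (hA : IsSymmetric A) {n : ℕ} {x : A} :
    x ∈ AnnS A n ↔ ∀ (e : ℕ → BWord) (a : ℕ → A), a n = x → evalW e a n = ident := by
  induction n generalizing x with
  | zero =>
    exact ⟨fun h _ _ ha => ha.trans h, fun h => h (fun _ => BWord.g) (fun _ => x) rfl⟩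
  | succ n ih =>
    constructor
    · intro h e a hx
      rw [evalW_add]
      refine ih.1 (evalX_mem_AnnS hA h (e n) (a n)) _ _ ?_
      simp only [lt_irrefl, if_false, evalW, Nat.add_zero, Nat.zero_add, hx]
    · intro h b
      have key : ∀ w : BWord, evalX w b x ∈ AnnS A n := by
        intro w
        refine ih.2 fun e a ha => ?_
        have := h (fun i => if i < n then e i else w)
          (fun i => if i < n then a i else if i = n then b else x) (by simp)
        rw [evalW_add] at this
        rw [← this]
        refine evalW_congr (fun i hi => by simp [hi]) fun i hi => ?_
        rcases hi.lt_or_eq with hi | rfl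
        · simp [hi]
        · simp [evalW, ha]
      exact ⟨key BWord.sbar, key BWord.s, key BWord.gbar⟩

end Words

section Hom

variable {B : Type u} {C : Type v} [SkewBrace B] [SkewBrace C] {f : B → C}

theorem cosetRel_iff_mem {I : Set B} {a b : B} : cosetRel I a b ↔ dmul b (dinv a) ∈ I := by
  constructor
  · rintro ⟨c, hc, rfl⟩
    rwa [dmul_assoc, dmul_dinv, dmul_ident]
  · exact fun h => ⟨_, h, by rw [dmul_assoc, dinv_dmul, dmul_ident]⟩

namespace IsBraceHom

theorem map_ident (hf : IsBraceHom f) : f ident = ident := by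
  have h := hf.map_dmul ident ident
  rw [ident_dmul] at h
  calc f ident = dmul (dinv (f ident)) (dmul (f ident) (f ident)) := by
        rw [← dmul_assoc, dinv_dmul, ident_dmul]
    _ = ident := by rw [← h, dinv_dmul]

theorem map_dinv (hf : IsBraceHom f) (a : B) : f (dinv a) = dinv (f a) := by
  calc f (dinv a) = dmul (dmul (f (dinv a)) (f a)) (dinv (f a)) := by
        rw [dmul_assoc, dmul_dinv, dmul_ident]
    _ = dinv (f a) := by rw [← hf.map_dmul, dinv_dmul, hf.map_ident, ident_dmul]

theorem map_cinv (hf : IsBraceHom f) (a : B) : f (cinv a) = cinv (f a) := by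
  calc f (cinv a) = cmul (cmul (f (cinv a)) (f a)) (cinv (f a)) := by
        rw [cmul_assoc, cmul_cinv, cmul_ident]
    _ = cinv (f a) := by rw [← hf.map_cmul, cinv_cmul, hf.map_ident, ident_cmul]

theorem map_dcomm (hf : IsBraceHom f) (a b : B) : f (dcomm a b) = dcomm (f a) (f b) := by
  simp only [dcomm, hf.map_dmul, hf.map_dinv]

theorem map_bstar (hf : IsBraceHom f) (a b : B) : f (bstar a b) = bstar (f a) (f b) := by
  simp only [bstar, lam, hf.map_dmul, hf.map_dinv, hf.map_cmul]

theorem map_evalX (hf : IsBraceHom f) (e : BWord) (a b : B) :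
    f (evalX e a b) = evalX e (f a) (f b) := by
  cases e <;> simp only [evalX, hf.map_dcomm, hf.map_bstar]

theorem map_evalW (hf : IsBraceHom f) (e : ℕ → BWord) (a : ℕ → B) (n : ℕ) :
    f (evalW e a n) = evalW e (fun i => f (a i)) n := by
  induction n generalizing e a with
  | zero => rfl
  | succ n ih => rw [evalW, evalW, hf.map_evalX, ih]

theorem isSymmetric (hf : IsBraceHom f) (hinj : Function.Injective f) (hC : IsSymmetric C) :
    IsSymmetric B := fun a b c => hinj <| by
  simpa only [hf.map_dmul, hf.map_cmul, hf.map_cinv] using hC (f a) (f b) (f c)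

theorem mem_AnnS_of_map (hf : IsBraceHom f) (hinj : Function.Injective f)
    (hC : IsSymmetric C) {n : ℕ} {b : B} (h : f b ∈ AnnS C n) : b ∈ AnnS B n := by
  rw [mem_AnnS_iff_evalW hC] at h
  rw [mem_AnnS_iff_evalW (hf.isSymmetric hinj hC)]
  intro e a ha
  apply hinj
  rw [hf.map_evalW, hf.map_ident]
  exact h e _ (congrArg f ha)

theorem map_mem_AnnS (hf : IsBraceHom f) (hinj : Function.Injective f)
    (hC : IsSymmetric C) {n : ℕ} (hsurj : ∀ c, ∃ b, cosetRel (AnnS C n) (f b) c) {b : B}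
    (h : b ∈ AnnS B n) : f b ∈ AnnS C n := by
  rw [mem_AnnS_iff_evalW (hf.isSymmetric hinj hC)] at h
  rw [mem_AnnS_iff_evalW hC]
  intro e c hc
  choose g hg using hsurj
  have h1 := h e (fun i => if i = n then b else g (c i)) (if_pos rfl)
  rw [hC.inClass n e (fun i => f (if i = n then b else g (c i))) c, ← hf.map_evalW, h1,
    hf.map_ident]
  intro i _
  by_cases hi : i = n
  · subst hi; simpa [hc] using cosetRel_refl i hC (f b)
  · simpa [hi] using hg (c i)

theorem cosetRel_of_map (hf : IsBraceHom f) (hinj : Function.Injective f)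
    (hC : IsSymmetric C) {n : ℕ} {a b : B} (h : cosetRel (AnnS C n) (f a) (f b)) :
    cosetRel (AnnS B n) a b := by
  rw [cosetRel_iff_mem] at *
  rw [← hf.map_dinv, ← hf.map_dmul] at h
  exact hf.mem_AnnS_of_map hinj hC h

theorem cosetRel_map_iff (hf : IsBraceHom f) (hinj : Function.Injective f)
    (hC : IsSymmetric C) {n : ℕ} (hsurj : ∀ c, ∃ b, cosetRel (AnnS C n) (f b) c) {a b : B} :
    cosetRel (AnnS C n) (f a) (f b) ↔ cosetRel (AnnS B n) a b := by
  refine ⟨hf.cosetRel_of_map hinj hC, fun h => ?_⟩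
  rw [cosetRel_iff_mem] at *
  rw [← hf.map_dinv, ← hf.map_dmul]
  exact hf.map_mem_AnnS hinj hC hsurj h

theorem mem_Asub_iff (hf : IsBraceHom f) (hC : IsSymmetric C) {n : ℕ}
    (hsurj : ∀ c, ∃ b, cosetRel (AnnS C n) (f b) c) {c : C} :
    c ∈ Asub C n ↔ ∃ b ∈ Asub B n, f b = c := by
  constructor
  · intro h
    induction h with
    | mem hx =>
      obtain ⟨s, hs, e, c, rfl⟩ := hx
      obtain ⟨k, rfl⟩ := Nat.exists_eq_add_of_le hs
      choose g hg using hsurj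
      rw [evalW_add]
      refine ⟨evalW e (fun i => g (if i < n then c i else
        evalW (fun j => e (n + j)) (fun j => c (n + j)) k)) n,
        .mem ⟨n, le_rfl, _, _, rfl⟩, ?_⟩
      rw [hf.map_evalW]
      exact (hC.inClass n e _ _ fun i _ => hg _).symm
    | one => exact ⟨ident, .one, hf.map_ident⟩
    | mul _ _ hx hy =>
      obtain ⟨a, ha, rfl⟩ := hx
      obtain ⟨b, hb, rfl⟩ := hy
      exact ⟨_, .mul ha hb, hf.map_dmul a b⟩
    | inv _ hx =>
      obtain ⟨a, ha, rfl⟩ := hx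
      exact ⟨_, .inv ha, hf.map_dinv a⟩
  · rintro ⟨b, hb, rfl⟩
    induction hb with
    | mem hx =>
      obtain ⟨s, hs, e, a, rfl⟩ := hx
      exact .mem ⟨s, hs, e, _, hf.map_evalW e a s⟩
    | one => rw [hf.map_ident]; exact .one
    | mul _ _ hx hy => rw [hf.map_dmul]; exact .mul hx hy
    | inv _ hx => rw [hf.map_dinv]; exact .inv hx

/-- An injective homomorphism into a symmetric skew brace `C` which is surjective modulo
`Ann_n(C)` is an `n`-isoclinism. -/
theorem isoclinicN (hf : IsBraceHom f) (hinj : Function.Injective f) (hC : IsSymmetric C)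
    {n : ℕ} (hsurj : ∀ c, ∃ b, cosetRel (AnnS C n) (f b) c) : IsoclinicN B C n := by
  refine ⟨f, f, ?_⟩
  constructor
  · exact fun a a' => (hf.cosetRel_map_iff hinj hC hsurj).symm
  · intro c
    obtain ⟨b, hb⟩ := hsurj c
    exact ⟨b, cosetRel_symm hC hb⟩
  · intro a a'
    rw [hf.map_dmul]
    exact cosetRel_refl n hC _
  · intro a a'
    rw [hf.map_cmul]
    exact cosetRel_refl n hC _
  · exact fun x hx => (hf.mem_Asub_iff hC hsurj).2 ⟨x, hx, rfl⟩
  · exact fun x _ y _ h => hinj h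
  · exact fun y hy => (hf.mem_Asub_iff hC hsurj).1 hy
  · exact fun x _ y _ => hf.map_dmul x y
  · exact fun x _ y _ => hf.map_cmul x y
  · intro e a b h
    rw [hf.map_evalW]
    exact hC.inClass n e _ _ h

/-- The inverse of the `n`-isoclinism given by an injective homomorphism into a symmetric skew
brace `C` which is surjective modulo `Ann_n(C)`. -/
theorem isoclinicN_symm (hf : IsBraceHom f) (hinj : Function.Injective f) (hC : IsSymmetric C)
    {n : ℕ} (hsurj : ∀ c, ∃ b, cosetRel (AnnS C n) (f b) c) : IsoclinicN C B n := by
  have hAsub := fun c => hf.mem_Asub_iff hC hsurj (c := c)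
  have hmap := fun a b => hf.cosetRel_map_iff hinj hC hsurj (a := a) (b := b)
  choose g hg using hsurj
  have : Nonempty B := ⟨ident⟩
  have hinv : ∀ b, Function.invFun f (f b) = b := Function.leftInverse_invFun hinj
  refine ⟨g, Function.invFun f, ?_⟩
  constructor
  · intro a a'
    rw [← hmap]
    exact ⟨fun h => cosetRel_trans hC (hg a) (cosetRel_trans hC h (cosetRel_symm hC (hg a'))),
      fun h => cosetRel_trans hC (cosetRel_symm hC (hg a)) (cosetRel_trans hC h (hg a'))⟩
  · intro b
    exact ⟨f b, (hmap _ _).1 (cosetRel_symm hC (hg (f b)))⟩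
  · intro a a'
    rw [← hmap, hf.map_dmul]
    exact cosetRel_trans hC (cosetRel_dmul hC (hg a) (hg a')) (cosetRel_symm hC (hg _))
  · intro a a'
    rw [← hmap, hf.map_cmul]
    exact cosetRel_trans hC (cosetRel_cmul hC (hg a) (hg a')) (cosetRel_symm hC (hg _))
  · intro x hx
    obtain ⟨b, hb, rfl⟩ := (hAsub x).1 hx
    rwa [hinv]
  · intro x hx y hy h
    obtain ⟨b, -, rfl⟩ := (hAsub x).1 hx
    obtain ⟨b', -, rfl⟩ := (hAsub y).1 hy
    rw [hinv, hinv] at h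
    rw [h]
  · exact fun b hb => ⟨f b, (hAsub _).2 ⟨b, hb, rfl⟩, hinv b⟩
  · intro x hx y hy
    obtain ⟨b, -, rfl⟩ := (hAsub x).1 hx
    obtain ⟨b', -, rfl⟩ := (hAsub y).1 hy
    rw [← hf.map_dmul, hinv, hinv, hinv]
  · intro x hx y hy
    obtain ⟨b, -, rfl⟩ := (hAsub x).1 hx
    obtain ⟨b', -, rfl⟩ := (hAsub y).1 hy
    rw [← hf.map_cmul, hinv, hinv, hinv]
  · intro e a b h
    rw [hC.inClass n e (fun i => f (b i)) a fun i hi =>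
      cosetRel_trans hC ((hmap _ _).2 (h i hi)) (hg (a i)), ← hf.map_evalW, hinv]

/-- If `C/Ann_n(C)` is finite and `C/Ann_n(C)` embeds into `B/Ann_n(B)`, then an injective
homomorphism `B → C` is surjective modulo `Ann_n(C)`. -/
theorem surjective_of_finite (hf : IsBraceHom f) (hinj : Function.Injective f)
    (hC : IsSymmetric C) {n : ℕ}
    (hfin : ∃ T : Set C, T.Finite ∧ ∀ c, ∃ t ∈ T, cosetRel (AnnS C n) t c) {ξ : C → B}
    (hξ : ∀ c c', cosetRel (AnnS B n) (ξ c) (ξ c') → cosetRel (AnnS C n) c c') (c : C) :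
    ∃ b, cosetRel (AnnS C n) (f b) c := by
  let r : Setoid C := ⟨cosetRel (AnnS C n), cosetRel_refl n hC, cosetRel_symm hC,
    cosetRel_trans hC⟩
  obtain ⟨T, hT, hcov⟩ := hfin
  have : Finite T := hT
  have : Finite (Quotient r) := Finite.of_surjective (fun t : T => Quotient.mk r t) fun q => by
    induction q using Quotient.inductionOn with
    | h c =>
      obtain ⟨t, ht, h⟩ := hcov c
      exact ⟨⟨t, ht⟩, Quotient.sound h⟩
  have hi : Function.Injective fun q : Quotient r => Quotient.mk r (f (ξ q.out)) := by
    intro q q' h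
    have := hξ _ _ (hf.cosetRel_of_map hinj hC (Quotient.exact h))
    rw [← q.out_eq, ← q'.out_eq]
    exact Quotient.sound this
  obtain ⟨q, hq⟩ := Finite.surjective_of_injective hi (Quotient.mk r c)
  exact ⟨_, Quotient.exact hq⟩

end IsBraceHom

theorem isBraceHom_subtype_val {A : Type u} [SkewBrace A] {S : Set A} (hS : IsSubBrace A S) :
    @IsBraceHom S A (subBrace S hS) _ Subtype.val :=
  @IsBraceHom.mk S A (subBrace S hS) _ _ (fun _ _ => rfl) fun _ _ => rfl

end Hom

end SkewBrace

open SkewBrace in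
/-- Let `A` be a symmetric skew brace, `B` (here: the set `S`) a sub-skew brace and `n ≥ 1`.
Then `B` and `B·Ann_n(A)` are `n`-isoclinic; in particular if `A = B·Ann_n(A)` then `A` and
`B` are `n`-isoclinic. Conversely, if `A/Ann_n(A)` is finite (there are only finitely many
cosets of `Ann_n(A)`) and `A` is `n`-isoclinic to `B`, then `A = B·Ann_n(A)`. -/
theorem subbrace_isoclinicN {A : Type u} [inst : SkewBrace A] (hA : IsSymmetric A)
    (n : ℕ) (hn : 1 ≤ n) (S : Set A) (hS : IsSubBrace A S) :
    (∃ h2 : IsSubBrace A (setDProd S (AnnS A n)),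
      @IsoclinicN S (setDProd S (AnnS A n)) (subBrace S hS) (subBrace _ h2) n) ∧
    (setDProd S (AnnS A n) = Set.univ →
      @IsoclinicN A S inst (subBrace S hS) n) ∧
    ((∃ T : Set A, T.Finite ∧ ∀ a : A, ∃ t ∈ T, cosetRel (AnnS A n) t a) →
      @IsoclinicN A S inst (subBrace S hS) n →
      setDProd S (AnnS A n) = Set.univ) := by
  have hval := isBraceHom_subtype_val hS
  have hsurj : setDProd S (AnnS A n) = Set.univ ↔ ∀ c : A, ∃ b : S, cosetRel (AnnS A n) b c := by
    simp [Set.eq_univ_iff_forall, mem_setDProd_iff hA]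
  refine ⟨⟨isSubBrace_setDProd hA hS, ?_⟩, fun h => ?_, fun hT => ?_⟩
  · let _ := subBrace S hS
    let _ := subBrace _ (isSubBrace_setDProd (n := n) hA hS)
    have hval' := isBraceHom_subtype_val (isSubBrace_setDProd (n := n) hA hS)
    have hsub : ∀ s ∈ S, s ∈ setDProd S (AnnS A n) := fun s hs =>
      (mem_setDProd_iff hA).2 ⟨s, hs, cosetRel_refl n hA s⟩
    have hincl : IsBraceHom fun s : S => (⟨s, hsub s s.2⟩ : setDProd S (AnnS A n)) :=
      ⟨fun _ _ => rfl, fun _ _ => rfl⟩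
    refine hincl.isoclinicN (fun _ _ h => Subtype.ext (Subtype.mk.inj h))
      (hval'.isSymmetric Subtype.val_injective hA) fun c => ?_
    obtain ⟨s, hs, h⟩ := (mem_setDProd_iff hA).1 c.2
    exact ⟨⟨s, hs⟩, hval'.cosetRel_of_map Subtype.val_injective hA h⟩
  · let _ := subBrace S hS
    exact hval.isoclinicN_symm Subtype.val_injective hA (hsurj.1 h)
  · let _ := subBrace S hS
    rintro ⟨ξ, θ, h⟩
    exact hsurj.2 (hval.surjective_of_finite Subtype.val_injective hA hT
      fun c c' => (h.xi_resp c c').2)
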